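/- Let 1 < p < ∞ and let Q₀ ⊂ ℝⁿ be a cube with sides parallel to the coordinate axes. Then, as sets of functions in L¹(Q₀), GaRo_p(Q₀) = L(p,∞)(Q₀); that is, for f ∈ L¹(Q₀), GaRo_p(f,Q₀) < ∞ if and only if sup_{t>0} t (λ_f(t))^{1/p} < ∞. -/

import Mathlib

open MeasureTheory Set
open scoped ENNReal NNReal

noncomputable section

/-- The distribution function `λ_f(t) = μ {x : |f(x)| > t}`. -/
def distFun {α : Type*} [MeasurableSpace α] (μ : Measure α) (f : α → ℝ) (t : ℝ) : ℝ≥0∞ :=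
  μ {x | t < |f x|}

/-- The non-increasing rearrangement `f*(t) = inf {s > 0 : λ_f(s) ≤ t}`. -/
def rearr {α : Type*} [MeasurableSpace α] (μ : Measure α) (f : α → ℝ) (t : ℝ) : ℝ≥0∞ :=
  sInf (ENNReal.ofReal '' {s : ℝ | 0 < s ∧ distFun μ f s ≤ ENNReal.ofReal t})

/-- The maximal function `f**(t) = (1/t) ∫₀ᵗ f*(s) ds`. -/
def dstar {α : Type*} [MeasurableSpace α] (μ : Measure α) (f : α → ℝ) (t : ℝ) : ℝ≥0∞ :=
  (∫⁻ s in Set.Ioc (0 : ℝ) t, rearr μ f s) / ENNReal.ofReal t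

/-- The `L(∞,∞)` "norm" : `sup_{t>0} (f**(t) - f*(t))`. -/
def oscNorm {α : Type*} [MeasurableSpace α] (μ : Measure α) (f : α → ℝ) : ℝ≥0∞ :=
  ⨆ (t : ℝ) (_ : 0 < t), dstar μ f t - rearr μ f t

/-- The Marcinkiewicz `L(p,∞)` quasinorm `‖f‖*_{L(p,∞)} = sup_{t>0} t (λ_f(t))^{1/p}`. -/
def wkNorm {α : Type*} [MeasurableSpace α] (μ : Measure α) (p : ℝ) (f : α → ℝ) : ℝ≥0∞ :=
  ⨆ (t : ℝ) (_ : 0 < t), ENNReal.ofReal t * distFun μ f t ^ (1 / p)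

/-- `‖f‖_{L(p,∞)} = sup_{s>0} s^{1/p} f**(s)`. -/
def wkNormStarStar {α : Type*} [MeasurableSpace α] (μ : Measure α) (p : ℝ) (f : α → ℝ) : ℝ≥0∞ :=
  ⨆ (s : ℝ) (_ : 0 < s), ENNReal.ofReal s ^ (1 / p) * dstar μ f s

/-- `‖f‖*_{L(p,∞)} = sup_{s>0} s^{1/p} f*(s)` (rearrangement form). -/
def wkNormStar {α : Type*} [MeasurableSpace α] (μ : Measure α) (p : ℝ) (f : α → ℝ) : ℝ≥0∞ :=
  ⨆ (s : ℝ) (_ : 0 < s), ENNReal.ofReal s ^ (1 / p) * rearr μ f s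

/-- `‖f‖^#_{L(p,∞)} = sup_{s>0} s^{1/p} (f**(s) - f*(s))`. -/
def sharpNorm {α : Type*} [MeasurableSpace α] (μ : Measure α) (p : ℝ) (f : α → ℝ) : ℝ≥0∞ :=
  ⨆ (s : ℝ) (_ : 0 < s), ENNReal.ofReal s ^ (1 / p) * (dstar μ f s - rearr μ f s)

/-- `‖f‖^{##}_{L(p,∞)} = sup_{t>0} (λ_f(t))^{-(1-1/p)} ∫_t^∞ λ_f(s) ds`. -/
def sharpSharpNorm {α : Type*} [MeasurableSpace α] (μ : Measure α) (p : ℝ) (f : α → ℝ) : ℝ≥0∞ :=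
  ⨆ (t : ℝ) (_ : 0 < t),
    distFun μ f t ^ (-(1 - 1 / p)) * ∫⁻ s in Set.Ioi t, distFun μ f s

/-- `‖f‖^{##}_{L(∞,∞)} = inf {C : ∫_t^∞ λ_f(s) ds ≤ C λ_f(t) for all t > 0}`. -/
def sharpSharpInf {α : Type*} [MeasurableSpace α] (μ : Measure α) (f : α → ℝ) : ℝ≥0∞ :=
  sInf {C : ℝ≥0∞ | ∀ t : ℝ, 0 < t →
    ∫⁻ s in Set.Ioi t, distFun μ f s ≤ C * distFun μ f t}

/-- O'Neil's quantity `inf {C^{1/p} : ∫_t^∞ λ_f(s) ds ≤ C t^{1-p} for all t > 0}`. -/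
def oneilQuantity {α : Type*} [MeasurableSpace α] (μ : Measure α) (p : ℝ) (f : α → ℝ) : ℝ≥0∞ :=
  sInf {D : ℝ≥0∞ | ∃ C : ℝ≥0∞, D = C ^ (1 / p) ∧
    ∀ t : ℝ, 0 < t → ∫⁻ s in Set.Ioi t, distFun μ f s ≤ C * ENNReal.ofReal t ^ (1 - p)}

/-- A cube in `ℝⁿ` with sides parallel to the coordinate axes. -/
def IsCube {n : ℕ} (Q : Set (Fin n → ℝ)) : Prop :=
  ∃ (a : Fin n → ℝ) (l : ℝ), 0 < l ∧ Q = Set.univ.pi fun i => Set.Icc (a i) (a i + l)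

/-- A countable family of subcubes of `Q₀` with pairwise disjoint interiors. -/
def IsPackingIn {n : ℕ} (Q₀ : Set (Fin n → ℝ)) (Q : ℕ → Set (Fin n → ℝ)) : Prop :=
  (∀ i, IsCube (Q i) ∧ Q i ⊆ Q₀) ∧
    Pairwise fun i j => interior (Q i) ∩ interior (Q j) = ∅

/-- The average `f_Q = (1/|Q|) ∫_Q f`. -/
def cubeAvg {n : ℕ} (f : (Fin n → ℝ) → ℝ) (Q : Set (Fin n → ℝ)) : ℝ :=
  ⨍ x in Q, f x

/-- The mean oscillation `(1/|Q|) ∫_Q |f - f_Q|`. -/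
def meanOsc {n : ℕ} (f : (Fin n → ℝ) → ℝ) (Q : Set (Fin n → ℝ)) : ℝ :=
  ⨍ x in Q, |f x - cubeAvg f Q|

/-- The John–Nirenberg functional `JN_p(f,Q₀)`. -/
def JN {n : ℕ} (p : ℝ) (f : (Fin n → ℝ) → ℝ) (Q₀ : Set (Fin n → ℝ)) : ℝ≥0∞ :=
  ⨆ (Q : ℕ → Set (Fin n → ℝ)) (_ : IsPackingIn Q₀ Q),
    (∑' i, volume (Q i) * ENNReal.ofReal (meanOsc f (Q i)) ^ p) ^ (1 / p)

/-- The BMO norm `‖f‖_{BMO(Q₀)}`. -/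
def bmoNorm {n : ℕ} (f : (Fin n → ℝ) → ℝ) (Q₀ : Set (Fin n → ℝ)) : ℝ≥0∞ :=
  ⨆ (Q : Set (Fin n → ℝ)) (_ : IsCube Q ∧ Q ⊆ Q₀), ENNReal.ofReal (meanOsc f Q)

/-- The Garsia–Rodemich functional `GaRo_p(f,Q₀)`: the least constant `C` such that
for every packing `{Qᵢ}` of `Q₀`,
`Σᵢ (1/|Qᵢ|) ∫_{Qᵢ}∫_{Qᵢ} |f(x)-f(y)| dx dy ≤ C (Σᵢ |Qᵢ|)^{1/p'}` where `1/p' = 1 - 1/p`. -/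
def GaRo {n : ℕ} (p : ℝ) (f : (Fin n → ℝ) → ℝ) (Q₀ : Set (Fin n → ℝ)) : ℝ≥0∞ :=
  sInf {C : ℝ≥0∞ | ∀ Q : ℕ → Set (Fin n → ℝ), IsPackingIn Q₀ Q →
    (∑' i, (volume (Q i))⁻¹ *
        ∫⁻ x in Q i, ∫⁻ y in Q i, ENNReal.ofReal |f x - f y|) ≤
      C * (∑' i, volume (Q i)) ^ (1 - 1 / p)}

/-- The double-integral oscillation of `f` over `Q` summed in the Garsia–Rodemich functional. -/
def pairOsc {n : ℕ} (f : (Fin n → ℝ) → ℝ) (Q : Set (Fin n → ℝ)) : ℝ≥0∞ :=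
  (volume Q)⁻¹ * ∫⁻ x in Q, ∫⁻ y in Q, ENNReal.ofReal |f x - f y|

/-- The closed axis-parallel cube with lower corner `a` and side length `l`. -/
def closedCube {n : ℕ} (a : Fin n → ℝ) (l : ℝ) : Set (Fin n → ℝ) :=
  Set.univ.pi fun i => Set.Icc (a i) (a i + l)

theorem isCube_closedCube {n : ℕ} (a : Fin n → ℝ) {l : ℝ} (hl : 0 < l) :
    IsCube (closedCube a l) :=
  ⟨a, l, hl, rfl⟩

theorem volume_closedCube {n : ℕ} (a : Fin n → ℝ) (l : ℝ) :
    volume (closedCube a l) = ENNReal.ofReal l ^ n := by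
  rw [closedCube, volume_pi_pi]
  simp

theorem interior_closedCube {n : ℕ} (a : Fin n → ℝ) (l : ℝ) :
    interior (closedCube a l) = Set.univ.pi fun i => Set.Ioo (a i) (a i + l) := by
  rw [closedCube, interior_pi_set Set.finite_univ]
  simp

namespace IsCube

variable {n : ℕ} {Q : Set (Fin n → ℝ)}

theorem isClosed (hQ : IsCube Q) : IsClosed Q := by
  obtain ⟨a, l, -, rfl⟩ := hQ
  exact isClosed_set_pi fun i _ => isClosed_Icc

theorem volume_ne_zero (hQ : IsCube Q) : volume Q ≠ 0 := by
  obtain ⟨a, l, hl, rfl⟩ := hQ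
  exact (volume_closedCube a l).trans_ne
    (pow_ne_zero n (ENNReal.ofReal_pos.2 hl).ne')

theorem volume_ne_top (hQ : IsCube Q) : volume Q ≠ ⊤ := by
  obtain ⟨a, l, hl, rfl⟩ := hQ
  exact (volume_closedCube a l).trans_ne (ENNReal.pow_ne_top ENNReal.ofReal_ne_top)

theorem interior_ae_eq (hQ : IsCube Q) : interior Q =ᵐ[volume] Q := by
  apply interior_ae_eq_of_null_frontier
  obtain ⟨a, l, hl, rfl⟩ := hQ
  exact (convex_pi fun i _ => convex_Icc _ _).addHaar_frontier volume

end IsCube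

theorem aedisjoint_of_interior {n : ℕ} {Q R : Set (Fin n → ℝ)} (hQ : IsCube Q) (hR : IsCube R)
    (h : interior Q ∩ interior R = ∅) : AEDisjoint volume Q R := by
  have h1 : (Q ∩ R : Set (Fin n → ℝ)) =ᵐ[volume] (∅ : Set (Fin n → ℝ)) := by
    rw [← h]
    exact (hQ.interior_ae_eq.inter hR.interior_ae_eq).symm
  exact ae_eq_empty.1 h1

theorem lintegral_iUnion_cubes {n : ℕ} {ι : Type*} [Countable ι] {Q : ι → Set (Fin n → ℝ)}
    (hQ : ∀ i, IsCube (Q i)) (hd : Pairwise fun i j => interior (Q i) ∩ interior (Q j) = ∅)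
    (g : (Fin n → ℝ) → ℝ≥0∞) : ∫⁻ x in ⋃ i, Q i, g x = ∑' i, ∫⁻ x in Q i, g x :=
  lintegral_iUnion₀ (fun i => (hQ i).isClosed.measurableSet.nullMeasurableSet)
    (fun i j hij => aedisjoint_of_interior (hQ i) (hQ j) (hd hij)) g

theorem volume_iUnion_cubes {n : ℕ} {ι : Type*} [Countable ι] {Q : ι → Set (Fin n → ℝ)}
    (hQ : ∀ i, IsCube (Q i)) (hd : Pairwise fun i j => interior (Q i) ∩ interior (Q j) = ∅) :
    volume (⋃ i, Q i) = ∑' i, volume (Q i) := by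
  simpa using lintegral_iUnion_cubes hQ hd 1

/-- Disjoint subcubes along the diagonal of a cube, shrinking to its lower corner. -/
theorem exists_diagonal_cubes {n : ℕ} (hn : 0 < n) {R : Set (Fin n → ℝ)} (hR : IsCube R) :
    ∃ T : ℕ → Set (Fin n → ℝ), IsPackingIn R T := by
  obtain ⟨a, l, hl, rfl⟩ := hR
  have hpos (k : ℕ) : 0 < l / 2 ^ (k + 1) := by positivity
  refine ⟨fun k => closedCube (fun i => a i + l / 2 ^ (k + 1)) (l / 2 ^ (k + 1)), ?_, ?_⟩
  · refine fun k => ⟨isCube_closedCube _ (hpos k), pi_mono fun i _ => Icc_subset_Icc ?_ ?_⟩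
    · linarith [hpos k]
    · have : l / 2 ^ (k + 1) + l / 2 ^ (k + 1) = l / 2 ^ k := by field_simp; ring
      have h2 : l / 2 ^ k ≤ l := div_le_self hl.le (one_le_pow₀ (by norm_num))
      linarith
  · have key {j k : ℕ} (hjk : j < k) : l / 2 ^ (k + 1) + l / 2 ^ (k + 1) ≤ l / 2 ^ (j + 1) := by
      have : l / 2 ^ (k + 1) + l / 2 ^ (k + 1) = l / 2 ^ k := by field_simp; ring
      rw [this]
      gcongr <;> [norm_num; omega]
    have hdisj {j k : ℕ} (hjk : j < k) {x : Fin n → ℝ}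
        (hx : x ⟨0, hn⟩ ∈ Ioo (a ⟨0, hn⟩ + l / 2 ^ (j + 1))
          (a ⟨0, hn⟩ + l / 2 ^ (j + 1) + l / 2 ^ (j + 1)))
        (hx' : x ⟨0, hn⟩ ∈ Ioo (a ⟨0, hn⟩ + l / 2 ^ (k + 1))
          (a ⟨0, hn⟩ + l / 2 ^ (k + 1) + l / 2 ^ (k + 1))) : False := by
      have := key hjk
      linarith [hx.1, hx'.2]
    intro j k hjk
    rw [interior_closedCube, interior_closedCube, eq_empty_iff_forall_notMem]
    rintro x ⟨hx, hx'⟩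
    rcases lt_or_gt_of_ne hjk with h | h
    · exact hdisj h (hx _ trivial) (hx' _ trivial)
    · exact hdisj h (hx' _ trivial) (hx _ trivial)

/-- A Garsia–Rodemich bound extends from sequences to countable families of cubes, as soon as the
family leaves some cube free to be filled with small additional cubes. -/
theorem tsum_pairOsc_le {n : ℕ} (hn : 0 < n) {r : ℝ} {f : (Fin n → ℝ) → ℝ}
    {Q₀ : Set (Fin n → ℝ)} {C : ℝ≥0∞} (hC : C ≠ ⊤) (hQ₀ : volume Q₀ ≠ ⊤)
    (hbound : ∀ Q : ℕ → Set (Fin n → ℝ), IsPackingIn Q₀ Q →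
      ∑' i, pairOsc f (Q i) ≤ C * (∑' i, volume (Q i)) ^ r)
    {ι : Type*} [Countable ι] {Q : ι → Set (Fin n → ℝ)} (hQ : ∀ i, IsCube (Q i) ∧ Q i ⊆ Q₀)
    (hd : Pairwise fun i j => interior (Q i) ∩ interior (Q j) = ∅)
    {R : Set (Fin n → ℝ)} (hR : IsCube R) (hRQ₀ : R ⊆ Q₀)
    (hRQ : ∀ i, interior (Q i) ∩ interior R = ∅) :
    ∑' i, pairOsc f (Q i) ≤ C * (∑' i, volume (Q i)) ^ r := by
  obtain ⟨T, hT, hTd⟩ := exists_diagonal_cubes hn hR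
  have hfin : ∑' k, volume (T k) ≠ ⊤ := by
    rw [← volume_iUnion_cubes (fun k => (hT k).1) hTd]
    exact measure_ne_top_of_subset (iUnion_subset fun k => (hT k).2.trans hRQ₀) hQ₀
  obtain ⟨e⟩ := nonempty_equiv_of_countable (α := ι ⊕ ℕ) (β := ℕ)
  have hQT (i : ι) (k : ℕ) : interior (Q i) ∩ interior (T k) = ∅ :=
    subset_eq_empty (inter_subset_inter_right _ (interior_mono (hT k).2)) (hRQ i)
  have hN (N : ℕ) : ∑' i, pairOsc f (Q i) ≤
      C * (∑' i, volume (Q i) + ∑' k, volume (T (k + N))) ^ r := by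
    set F : ι ⊕ ℕ → Set (Fin n → ℝ) := Sum.elim Q fun k => T (k + N) with hF
    have hsum (φ : Set (Fin n → ℝ) → ℝ≥0∞) :
        ∑' m, φ (F (e.symm m)) = ∑' i, φ (Q i) + ∑' k, φ (T (k + N)) := by
      rw [e.symm.tsum_eq fun s => φ (F s)]
      exact Summable.tsum_sum ENNReal.summable ENNReal.summable
    have hF₁ (s : ι ⊕ ℕ) : IsCube (F s) ∧ F s ⊆ Q₀ := by
      rcases s with i | k
      · exact hQ i
      · exact ⟨(hT _).1, (hT _).2.trans hRQ₀⟩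
    have hF₂ : Pairwise fun s s' => interior (F s) ∩ interior (F s') = ∅ := by
      rintro (i | k) (i' | k') hne
      · exact hd fun h => hne (by rw [h])
      · exact hQT _ _
      · exact (inter_comm _ _).trans (hQT _ _)
      · exact hTd fun h => hne (by rw [Nat.add_right_cancel h])
    have := hbound (fun m => F (e.symm m))
      ⟨fun m => hF₁ _, fun m m' hmm => hF₂ (e.symm.injective.ne hmm)⟩
    rw [hsum, hsum] at this
    exact le_self_add.trans this
  have hlim : Filter.Tendsto (fun N => C * (∑' i, volume (Q i) + ∑' k, volume (T (k + N))) ^ r)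
      Filter.atTop (nhds (C * (∑' i, volume (Q i) + 0) ^ r)) :=
    ENNReal.Tendsto.const_mul
      ((ENNReal.continuous_rpow_const.tendsto _).comp
        (tendsto_const_nhds.add (ENNReal.tendsto_sum_nat_add _ hfin))) (Or.inr hC)
  simpa using ge_of_tendsto' hlim hN

/-- The index of the dyadic subcube of generation `k` containing `x`, relative to the cube with
lower corner `a` and side length `l`. -/
def dyadicIndex {n : ℕ} (a : Fin n → ℝ) (l : ℝ) (k : ℕ) (x : Fin n → ℝ) : Fin n → ℤ :=
  fun i => ⌊2 ^ k * ((x i - a i) / l)⌋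

/-- The half-open dyadic cube of generation `k` and index `j`. -/
def dyadicCell {n : ℕ} (a : Fin n → ℝ) (l : ℝ) (k : ℕ) (j : Fin n → ℤ) : Set (Fin n → ℝ) :=
  {x | dyadicIndex a l k x = j}

/-- The lower corner of `dyadicCell a l k j`. -/
def dyadicCorner {n : ℕ} (a : Fin n → ℝ) (l : ℝ) (k : ℕ) (j : Fin n → ℤ) : Fin n → ℝ :=
  fun i => a i + j i * (l / 2 ^ k)

/-- The closed dyadic cube of generation `k` and index `j`. -/
def dyadicCube {n : ℕ} (a : Fin n → ℝ) (l : ℝ) (k : ℕ) (j : Fin n → ℤ) : Set (Fin n → ℝ) :=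
  closedCube (dyadicCorner a l k j) (l / 2 ^ k)

section Dyadic

variable {n : ℕ} {a : Fin n → ℝ} {l : ℝ}

theorem isCube_dyadicCube (hl : 0 < l) (k : ℕ) (j : Fin n → ℤ) : IsCube (dyadicCube a l k j) :=
  isCube_closedCube _ (by positivity)

theorem dyadicCell_eq_pi (hl : 0 < l) (k : ℕ) (j : Fin n → ℤ) :
    dyadicCell a l k j = Set.univ.pi fun i =>
      Set.Ico (dyadicCorner a l k j i) (dyadicCorner a l k j i + l / 2 ^ k) := by
  ext x
  simp only [dyadicCell, dyadicIndex, dyadicCorner, mem_ofPred_eq, funext_iff, mem_univ_pi, mem_Ico,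
    Int.floor_eq_iff]
  refine forall_congr' fun i => and_congr ?_ ?_
  · rw [← mul_div_assoc, le_div_iff₀ hl, ← mul_div_assoc, ← le_sub_iff_add_le',
      div_le_iff₀' (by positivity)]
  · rw [← mul_div_assoc, div_lt_iff₀ hl, ← mul_div_assoc, add_assoc, ← add_div,
      ← sub_lt_iff_lt_add', lt_div_iff₀' (by positivity), add_one_mul]

theorem dyadicCell_ae_eq (hl : 0 < l) (k : ℕ) (j : Fin n → ℤ) :
    dyadicCell a l k j =ᵐ[volume] dyadicCube a l k j := by
  rw [dyadicCell_eq_pi hl, dyadicCube, closedCube, pi_univ_Icc]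
  exact Measure.univ_pi_Ico_ae_eq_Icc

theorem dyadicCell_subset_dyadicCube (hl : 0 < l) (k : ℕ) (j : Fin n → ℤ) :
    dyadicCell a l k j ⊆ dyadicCube a l k j := by
  rw [dyadicCell_eq_pi hl]
  exact pi_mono fun i _ => Ico_subset_Icc_self

theorem dyadicCube_subset (hl : 0 < l) {k k' : ℕ} {j j' : Fin n → ℤ}
    (h : dyadicCell a l k j ⊆ dyadicCell a l k' j') : dyadicCube a l k j ⊆ dyadicCube a l k' j' := by
  have hclos (k : ℕ) (j : Fin n → ℤ) :
      dyadicCube a l k j = closure (dyadicCell a l k j) := by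
    have : 0 < l / 2 ^ k := by positivity
    rw [dyadicCell_eq_pi hl, closure_pi_set, dyadicCube, closedCube]
    congr! 2 with i
    exact (closure_Ico (by linarith)).symm
  rw [hclos, hclos]
  exact closure_mono h

theorem interior_dyadicCube_subset (hl : 0 < l) (k : ℕ) (j : Fin n → ℤ) :
    interior (dyadicCube a l k j) ⊆ dyadicCell a l k j := by
  rw [dyadicCell_eq_pi hl, dyadicCube, interior_closedCube]
  exact pi_mono fun i _ => Ioo_subset_Ico_self

theorem interior_dyadicCube_inter (hl : 0 < l) {k k' : ℕ} {j j' : Fin n → ℤ}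
    (h : Disjoint (dyadicCell a l k j) (dyadicCell a l k' j')) :
    interior (dyadicCube a l k j) ∩ interior (dyadicCube a l k' j') = ∅ :=
  disjoint_iff_inter_eq_empty.1
    (h.mono (interior_dyadicCube_subset hl _ _) (interior_dyadicCube_subset hl _ _))

theorem volume_dyadicCell (hl : 0 < l) (k : ℕ) (j : Fin n → ℤ) :
    volume (dyadicCell a l k j) = ENNReal.ofReal (l / 2 ^ k) ^ n := by
  rw [measure_congr (dyadicCell_ae_eq hl k j), dyadicCube, volume_closedCube]

theorem measurableSet_dyadicCell (hl : 0 < l) (k : ℕ) (j : Fin n → ℤ) :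
    MeasurableSet (dyadicCell a l k j) := by
  rw [dyadicCell_eq_pi hl]
  exact MeasurableSet.univ_pi fun i => measurableSet_Ico

theorem volume_dyadicCell_succ (hl : 0 < l) (k : ℕ) (j j' : Fin n → ℤ) :
    volume (dyadicCell a l k j) = 2 ^ n * volume (dyadicCell a l (k + 1) j') := by
  rw [volume_dyadicCell hl, volume_dyadicCell hl, ← mul_pow]
  congr 1
  rw [← ENNReal.ofReal_ofNat 2, ← ENNReal.ofReal_mul zero_le_two]
  congr 1
  rw [pow_succ]
  field_simp

theorem dyadicIndex_eq_div {k m : ℕ} (hmk : m ≤ k) (x : Fin n → ℝ) (i : Fin n) :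
    dyadicIndex a l m x i = dyadicIndex a l k x i / (2 ^ (k - m) : ℕ) := by
  rw [dyadicIndex, dyadicIndex, ← Int.floor_div_natCast]
  congr 1
  obtain ⟨d, rfl⟩ := Nat.exists_eq_add_of_le hmk
  rw [Nat.add_sub_cancel_left, pow_add]
  push_cast
  field_simp

theorem dyadicIndex_eq_of_le {k m : ℕ} (hmk : m ≤ k) {x y : Fin n → ℝ}
    (h : dyadicIndex a l k x = dyadicIndex a l k y) :
    dyadicIndex a l m x = dyadicIndex a l m y := by
  ext i
  rw [dyadicIndex_eq_div hmk, dyadicIndex_eq_div hmk, h]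

theorem dyadicCell_subset_of_le {k m : ℕ} (hmk : m ≤ k) (x : Fin n → ℝ) :
    dyadicCell a l k (dyadicIndex a l k x) ⊆ dyadicCell a l m (dyadicIndex a l m x) :=
  fun _ hy => dyadicIndex_eq_of_le hmk hy

/-- The points of the half-open unit dyadic cell lying in some dyadic cube on which the mean of `g`
exceeds `t`. -/
def maximalLevel (a : Fin n → ℝ) (l : ℝ) (g : (Fin n → ℝ) → ℝ≥0∞) (t : ℝ≥0∞) :
    Set (Fin n → ℝ) :=
  {x ∈ dyadicCell a l 0 0 | ∃ k, t * volume (dyadicCell a l k (dyadicIndex a l k x)) <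
    ∫⁻ y in dyadicCell a l k (dyadicIndex a l k x), g y}

/-- The generations and indices of the Calderón–Zygmund cubes of `g` at level `t`: the maximal
dyadic cubes on which the mean of `g` exceeds `t`. -/
def stoppingCubes (a : Fin n → ℝ) (l : ℝ) (g : (Fin n → ℝ) → ℝ≥0∞) (t : ℝ≥0∞) :
    Set (ℕ × (Fin n → ℤ)) :=
  {q | ∃ x ∈ dyadicCell a l 0 0, dyadicIndex a l q.1 x = q.2 ∧
    t * volume (dyadicCell a l q.1 q.2) < ∫⁻ y in dyadicCell a l q.1 q.2, g y ∧
    ∀ m < q.1, ∫⁻ y in dyadicCell a l m (dyadicIndex a l m x), g y ≤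
      t * volume (dyadicCell a l m (dyadicIndex a l m x))}

variable {g : (Fin n → ℝ) → ℝ≥0∞} {t : ℝ≥0∞}

theorem maximalLevel_eq_iUnion : maximalLevel a l g t =
    ⋃ q : stoppingCubes a l g t, dyadicCell a l q.1.1 q.1.2 := by
  classical
  ext x
  simp only [mem_iUnion, Subtype.exists, exists_prop, Prod.exists]
  constructor
  · rintro ⟨hx, hk⟩
    refine ⟨Nat.find hk, _, ⟨x, hx, rfl, Nat.find_spec hk, fun m hm => ?_⟩, rfl⟩
    exact not_lt.1 (Nat.find_min hk hm)
  · rintro ⟨k, j, ⟨z, hz, hj, hlt, -⟩, hx⟩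
    have hxj : dyadicIndex a l k x = j := hx
    refine ⟨?_, k, by rwa [hxj]⟩
    exact (dyadicIndex_eq_of_le (Nat.zero_le k) (hxj.trans hj.symm)).trans hz

theorem maximalLevel_anti {s : ℝ≥0∞} (h : s ≤ t) : maximalLevel a l g t ⊆ maximalLevel a l g s :=
  fun _ ⟨hx, k, hk⟩ => ⟨hx, k, (mul_le_mul_left h _).trans_lt hk⟩

theorem disjoint_stoppingCubes : Pairwise fun q q' : stoppingCubes a l g t =>
    Disjoint (dyadicCell a l q.1.1 q.1.2) (dyadicCell a l q'.1.1 q'.1.2) := by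
  have key {k k' : ℕ} {j j' : Fin n → ℤ} (hkk : k < k') (hq : (k, j) ∈ stoppingCubes a l g t)
      (hq' : (k', j') ∈ stoppingCubes a l g t) {z : Fin n → ℝ} (hz : z ∈ dyadicCell a l k j)
      (hz' : z ∈ dyadicCell a l k' j') : False := by
    obtain ⟨x, -, hx, hlt, -⟩ := hq
    obtain ⟨x', -, hx', -, hle⟩ := hq'
    have h1 : dyadicIndex a l k x' = j :=
      (dyadicIndex_eq_of_le hkk.le (hx'.trans hz'.symm)).trans hz
    have h2 := hle k hkk
    rw [h1] at h2
    exact absurd hlt h2.not_gt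
  rintro ⟨⟨k, j⟩, hq⟩ ⟨⟨k', j'⟩, hq'⟩ hne
  rw [Set.disjoint_left]
  intro z hz hz'
  rcases lt_trichotomy k k' with h | rfl | h
  · exact key h hq hq' hz hz'
  · exact hne (by simp [← (show _ = j from hz), ← (show _ = j' from hz')])
  · exact key h hq' hq hz' hz

theorem interior_stoppingCubes (hl : 0 < l) : Pairwise fun q q' : stoppingCubes a l g t =>
    interior (dyadicCube a l q.1.1 q.1.2) ∩ interior (dyadicCube a l q'.1.1 q'.1.2) = ∅ :=
  fun _ _ h => interior_dyadicCube_inter hl (disjoint_stoppingCubes h)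

theorem lintegral_maximalLevel (hl : 0 < l) (h : (Fin n → ℝ) → ℝ≥0∞) :
    ∫⁻ x in maximalLevel a l g t, h x =
      ∑' q : stoppingCubes a l g t, ∫⁻ x in dyadicCell a l q.1.1 q.1.2, h x := by
  rw [maximalLevel_eq_iUnion]
  exact lintegral_iUnion (fun q => measurableSet_dyadicCell hl _ _) disjoint_stoppingCubes _

theorem volume_maximalLevel (hl : 0 < l) : volume (maximalLevel a l g t) =
    ∑' q : stoppingCubes a l g t, volume (dyadicCell a l q.1.1 q.1.2) := by
  simpa using lintegral_maximalLevel hl 1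

theorem measurableSet_maximalLevel (hl : 0 < l) : MeasurableSet (maximalLevel a l g t) := by
  rw [maximalLevel_eq_iUnion]
  exact MeasurableSet.iUnion fun q => measurableSet_dyadicCell hl _ _

theorem mul_volume_maximalLevel_le (hl : 0 < l) :
    t * volume (maximalLevel a l g t) ≤ ∫⁻ x in maximalLevel a l g t, g x := by
  rw [volume_maximalLevel hl, lintegral_maximalLevel hl, ← ENNReal.tsum_mul_left]
  exact ENNReal.tsum_le_tsum fun q => q.2.choose_spec.2.2.1.le

theorem generation_pos_of_mem_stoppingCubes
    (ht : ∫⁻ x in dyadicCell a l 0 0, g x ≤ t * volume (dyadicCell a l 0 0))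
    {q : ℕ × (Fin n → ℤ)} (hq : q ∈ stoppingCubes a l g t) : 0 < q.1 := by
  obtain ⟨k, j⟩ := q
  obtain ⟨x, hx, hj, hlt, -⟩ := hq
  dsimp only at hj
  subst hj
  rcases Nat.eq_zero_or_pos k with rfl | h
  · have hx0 : dyadicIndex a l 0 x = 0 := hx
    simp only [hx0] at hlt
    exact absurd hlt ht.not_gt
  · exact h

theorem lintegral_stoppingCube_le (hl : 0 < l)
    (ht : ∫⁻ x in dyadicCell a l 0 0, g x ≤ t * volume (dyadicCell a l 0 0))
    {q : ℕ × (Fin n → ℤ)} (hq : q ∈ stoppingCubes a l g t) :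
    ∫⁻ x in dyadicCell a l q.1 q.2, g x ≤ 2 ^ n * t * volume (dyadicCell a l q.1 q.2) := by
  have hpos := generation_pos_of_mem_stoppingCubes ht hq
  obtain ⟨k, j⟩ := q
  obtain ⟨k, rfl⟩ := Nat.exists_eq_succ_of_ne_zero hpos.ne'
  obtain ⟨x, hx, hj, -, hle⟩ := hq
  dsimp only at hj
  subst hj
  calc ∫⁻ y in dyadicCell a l (k + 1) (dyadicIndex a l (k + 1) x), g y
      ≤ ∫⁻ y in dyadicCell a l k (dyadicIndex a l k x), g y :=
        lintegral_mono_set (dyadicCell_subset_of_le k.le_succ x)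
    _ ≤ t * volume (dyadicCell a l k (dyadicIndex a l k x)) := hle k k.lt_succ_self
    _ = _ := by
        rw [volume_dyadicCell_succ hl k _ (dyadicIndex a l (k + 1) x)]
        ring


theorem dyadicCube_zero_zero : dyadicCube a l 0 0 = closedCube a l := by
  simp [dyadicCube, closedCube, dyadicCorner]

theorem stoppingCube_subset {q : ℕ × (Fin n → ℤ)} (hq : q ∈ stoppingCubes a l g t) :
    dyadicCell a l q.1 q.2 ⊆ dyadicCell a l 0 0 := by
  obtain ⟨x, hx, hj, -⟩ := hq
  have hx0 : dyadicIndex a l 0 x = 0 := hx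
  rw [← hj, ← hx0]
  exact dyadicCell_subset_of_le (Nat.zero_le _) x

theorem disjoint_dyadicCell {k : ℕ} {j j' : Fin n → ℤ} (h : j ≠ j') :
    Disjoint (dyadicCell a l k j) (dyadicCell a l k j') :=
  Set.disjoint_left.2 fun _ hx hx' => h (Eq.trans (Eq.symm hx) hx')

theorem dyadicCell_one_subset {c : ℤ} (hc : c / 2 = 0) :
    dyadicCell a l 1 (fun _ => c) ⊆ dyadicCell a l 0 0 := by
  intro x hx
  have hx1 : dyadicIndex a l 1 x = fun _ => c := hx
  show dyadicIndex a l 0 x = 0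
  ext i
  rw [dyadicIndex_eq_div zero_le_one, hx1]
  simpa using hc

theorem tsum_pairOsc_stoppingCubes_comp_le (hn : 0 < n) (hl : 0 < l) {r : ℝ} (hr : 0 ≤ r)
    {f : (Fin n → ℝ) → ℝ} {C : ℝ≥0∞} (hC : C ≠ ⊤)
    (hbound : ∀ Q : ℕ → Set (Fin n → ℝ), IsPackingIn (closedCube a l) Q →
      ∑' i, pairOsc f (Q i) ≤ C * (∑' i, volume (Q i)) ^ r)
    {ι : Type*} [Countable ι] {e : ι → stoppingCubes a l g t} (he : Function.Injective e)
    {c : ℤ} (hc : c / 2 = 0)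
    (hdisj : ∀ i, Disjoint (dyadicCell a l (e i).1.1 (e i).1.2) (dyadicCell a l 1 fun _ => c)) :
    ∑' i, pairOsc f (dyadicCube a l (e i).1.1 (e i).1.2) ≤
      C * volume (maximalLevel a l g t) ^ r := by
  have hsub {k : ℕ} {j : Fin n → ℤ} (h : dyadicCell a l k j ⊆ dyadicCell a l 0 0) :
      dyadicCube a l k j ⊆ closedCube a l :=
    (dyadicCube_subset hl h).trans_eq dyadicCube_zero_zero
  have hvol : ∑' i, volume (dyadicCube a l (e i).1.1 (e i).1.2) ≤
      volume (maximalLevel a l g t) := by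
    simp_rw [← measure_congr (dyadicCell_ae_eq hl _ _)]
    rw [volume_maximalLevel hl]
    exact ENNReal.tsum_comp_le_tsum_of_injective he
      fun q : stoppingCubes a l g t => volume (dyadicCell a l q.1.1 q.1.2)
  have hpack := tsum_pairOsc_le hn hC (isCube_closedCube a hl).volume_ne_top hbound
    (Q := fun i => dyadicCube a l (e i).1.1 (e i).1.2)
    (fun i => ⟨isCube_dyadicCube hl _ _, hsub (stoppingCube_subset (e i).2)⟩)
    (fun i i' h => interior_stoppingCubes hl (he.ne h))
    (isCube_dyadicCube hl 1 fun _ => c) (hsub (dyadicCell_one_subset hc))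
    (fun i => interior_dyadicCube_inter hl (hdisj i))
  exact hpack.trans (by gcongr)

theorem tsum_pairOsc_stoppingCubes_le (hn : 0 < n) (hl : 0 < l) {r : ℝ} (hr : 0 ≤ r)
    {f : (Fin n → ℝ) → ℝ} {C : ℝ≥0∞} (hC : C ≠ ⊤)
    (hbound : ∀ Q : ℕ → Set (Fin n → ℝ), IsPackingIn (closedCube a l) Q →
      ∑' i, pairOsc f (Q i) ≤ C * (∑' i, volume (Q i)) ^ r)
    (ht : ∫⁻ x in dyadicCell a l 0 0, g x ≤ t * volume (dyadicCell a l 0 0)) :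
    ∑' q : stoppingCubes a l g t, pairOsc f (dyadicCube a l q.1.1 q.1.2) ≤
      2 * (C * volume (maximalLevel a l g t) ^ r) := by
  obtain ⟨s, hs⟩ : ∃ s : Set (stoppingCubes a l g t), ∀ q, q ∈ s ↔
      dyadicCell a l q.1.1 q.1.2 ⊆ dyadicCell a l 1 fun _ => 0 := ⟨{q | _}, fun _ => Iff.rfl⟩
  have h1 (q : s) : Disjoint (dyadicCell a l q.1.1.1 q.1.1.2) (dyadicCell a l 1 fun _ => 1) := by
    have hne : (fun _ : Fin n => (0 : ℤ)) ≠ fun _ => 1 :=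
      fun h => zero_ne_one (congrFun h ⟨0, hn⟩)
    exact (disjoint_dyadicCell hne).mono_left ((hs _).1 q.2)
  have h0 (q : (sᶜ : Set (stoppingCubes a l g t))) :
      Disjoint (dyadicCell a l q.1.1.1 q.1.1.2) (dyadicCell a l 1 fun _ => 0) := by
    obtain ⟨x, -, hj, -⟩ := q.1.2
    have hsub : dyadicCell a l q.1.1.1 q.1.1.2 ⊆ dyadicCell a l 1 (dyadicIndex a l 1 x) := by
      rw [← hj]
      exact dyadicCell_subset_of_le (generation_pos_of_mem_stoppingCubes ht q.1.2) x
    exact (disjoint_dyadicCell fun h =>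
      q.2 ((hs _).2 (hsub.trans_eq (by rw [h])))).mono_left hsub
  rw [← ENNReal.summable.tsum_add_tsum_compl (s := s) ENNReal.summable, two_mul]
  exact add_le_add
    (tsum_pairOsc_stoppingCubes_comp_le hn hl hr hC hbound Subtype.coe_injective (by decide) h1)
    (tsum_pairOsc_stoppingCubes_comp_le hn hl hr hC hbound Subtype.coe_injective (by decide) h0)

end Dyadic

theorem lintegral_le_pairOsc_add {n : ℕ} {f : (Fin n → ℝ) → ℝ} {Q S : Set (Fin n → ℝ)}
    (hQ : IsCube Q) (hS : S ⊆ Q) (hf : AEMeasurable f (volume.restrict Q)) {b : ℝ≥0∞}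
    (hmean : ∫⁻ x in Q, ‖f x‖ₑ ≤ b * volume Q) :
    ∫⁻ x in S, ‖f x‖ₑ ≤ pairOsc f Q + b * volume S := by
  have h0 := hQ.volume_ne_zero
  have h1 := hQ.volume_ne_top
  have hpt (x : Fin n → ℝ) :
      ‖f x‖ₑ ≤ (volume Q)⁻¹ * (∫⁻ y in Q, ENNReal.ofReal |f x - f y|) + b := by
    have : ‖f x‖ₑ * volume Q ≤ (∫⁻ y in Q, ENNReal.ofReal |f x - f y|) + b * volume Q := by
      calc ‖f x‖ₑ * volume Q = ∫⁻ _ in Q, ‖f x‖ₑ := by simp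
        _ ≤ ∫⁻ y in Q, (ENNReal.ofReal |f x - f y| + ‖f y‖ₑ) := by
          refine lintegral_mono fun y => ?_
          rw [← Real.enorm_eq_ofReal_abs]
          simpa using enorm_add_le (f x - f y) (f y)
        _ = (∫⁻ y in Q, ENNReal.ofReal |f x - f y|) + ∫⁻ y in Q, ‖f y‖ₑ :=
          lintegral_add_right' _ hf.enorm
        _ ≤ _ := by gcongr
    calc ‖f x‖ₑ = (volume Q)⁻¹ * (‖f x‖ₑ * volume Q) := by
          rw [mul_left_comm, ENNReal.inv_mul_cancel h0 h1, mul_one]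
      _ ≤ (volume Q)⁻¹ * ((∫⁻ y in Q, ENNReal.ofReal |f x - f y|) + b * volume Q) := by gcongr
      _ = _ := by rw [mul_add, mul_left_comm _ b, ENNReal.inv_mul_cancel h0 h1, mul_one]
  calc ∫⁻ x in S, ‖f x‖ₑ
      ≤ ∫⁻ x in S, ((volume Q)⁻¹ * (∫⁻ y in Q, ENNReal.ofReal |f x - f y|) + b) :=
        lintegral_mono hpt
    _ = (∫⁻ x in S, (volume Q)⁻¹ * (∫⁻ y in Q, ENNReal.ofReal |f x - f y|)) + b * volume S := by
        rw [lintegral_add_right _ measurable_const, setLIntegral_const]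
    _ ≤ (∫⁻ x in Q, (volume Q)⁻¹ * (∫⁻ y in Q, ENNReal.ofReal |f x - f y|)) + b * volume S := by
        gcongr
    _ = _ := by rw [lintegral_const_mul' _ _ (ENNReal.inv_ne_top.2 h0), pairOsc]

section CalderonZygmund

variable {n : ℕ} {a : Fin n → ℝ} {l : ℝ} {f : (Fin n → ℝ) → ℝ}

theorem lintegral_maximalLevel_le (hl : 0 < l) (hf : IntegrableOn f (closedCube a l))
    {s t : ℝ≥0∞} (hts : t ≤ s)
    (ht : ∫⁻ x in dyadicCell a l 0 0, ‖f x‖ₑ ≤ t * volume (dyadicCell a l 0 0)) :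
    ∫⁻ x in maximalLevel a l (‖f ·‖ₑ) s, ‖f x‖ₑ ≤
      (∑' q : stoppingCubes a l (‖f ·‖ₑ) t, pairOsc f (dyadicCube a l q.1.1 q.1.2)) +
        2 ^ n * t * volume (maximalLevel a l (‖f ·‖ₑ) s) := by
  set Ω := maximalLevel a l (‖f ·‖ₑ) s with hΩ
  have hΩm : MeasurableSet Ω := measurableSet_maximalLevel hl
  have hsplit (h : (Fin n → ℝ) → ℝ≥0∞) : ∫⁻ x in Ω, h x =
      ∑' q : stoppingCubes a l (‖f ·‖ₑ) t, ∫⁻ x in Ω ∩ dyadicCell a l q.1.1 q.1.2, h x := by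
    have := lintegral_maximalLevel (a := a) hl (g := (‖f ·‖ₑ)) (t := t) (Ω.indicator h)
    rw [setLIntegral_indicator hΩm, inter_eq_left.2 (maximalLevel_anti hts)] at this
    rw [this]
    exact tsum_congr fun q => setLIntegral_indicator hΩm _
  have hvol : volume Ω = ∑' q : stoppingCubes a l (‖f ·‖ₑ) t,
      volume (Ω ∩ dyadicCell a l q.1.1 q.1.2) := by simpa using hsplit 1
  rw [hsplit, hvol, ← ENNReal.tsum_mul_left, ← ENNReal.tsum_add]
  refine ENNReal.tsum_le_tsum fun q => ?_
  have hcube : dyadicCube a l q.1.1 q.1.2 ⊆ closedCube a l := by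
    rw [← dyadicCube_zero_zero]
    exact dyadicCube_subset hl (stoppingCube_subset q.2)
  refine lintegral_le_pairOsc_add (isCube_dyadicCube hl _ _)
    (inter_subset_right.trans (dyadicCell_subset_dyadicCube hl _ _))
    (hf.mono_set hcube).aemeasurable ?_
  rw [← setLIntegral_congr (dyadicCell_ae_eq hl _ _), ← measure_congr (dyadicCell_ae_eq hl _ _)]
  exact lintegral_stoppingCube_le hl ht q.2

theorem closedBall_eq_dyadicCube (hl : 0 < l) (k : ℕ) (j : Fin n → ℤ) :
    Metric.closedBall (fun i => dyadicCorner a l k j i + l / 2 ^ (k + 1)) (l / 2 ^ (k + 1)) =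
      dyadicCube a l k j := by
  rw [closedBall_pi _ (by positivity), dyadicCube, closedCube]
  congr! 2 with i
  rw [Real.closedBall_eq_Icc, pow_succ]
  congr 1 <;> field_simp <;> ring

theorem ae_abs_le_of_notMem_maximalLevel (hl : 0 < l) (hf : IntegrableOn f (closedCube a l))
    {t : ℝ} (ht : 0 ≤ t) : ∀ᵐ x, x ∈ dyadicCell a l 0 0 →
      x ∉ maximalLevel a l (‖f ·‖ₑ) (ENNReal.ofReal t) → |f x| ≤ t := by
  have hmeas : MeasurableSet (closedCube a l) := (isCube_closedCube a hl).isClosed.measurableSet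
  have hF : LocallyIntegrable ((closedCube a l).indicator fun x => |f x|) volume :=
    ((integrable_indicator_iff hmeas).2 (Integrable.abs hf)).locallyIntegrable
  filter_upwards [IsUnifLocDoublingMeasure.ae_tendsto_average volume hF 1] with x hx hx0 hxt
  have hsub (k : ℕ) : dyadicCell a l k (dyadicIndex a l k x) ⊆ closedCube a l := by
    rw [← dyadicCube_zero_zero]
    refine Subset.trans ?_ (dyadicCell_subset_dyadicCube hl _ _)
    have h0 : dyadicIndex a l 0 x = 0 := hx0
    rw [← h0]
    exact dyadicCell_subset_of_le k.zero_le x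
  have hδ : Filter.Tendsto (fun k : ℕ => l / 2 ^ (k + 1)) Filter.atTop (nhdsWithin 0 (Ioi 0)) := by
    refine tendsto_nhdsWithin_iff.2 ⟨?_, Filter.Eventually.of_forall fun k => ?_⟩
    · have := (tendsto_pow_atTop_nhds_zero_of_lt_one (r := (1 / 2 : ℝ)) (by norm_num)
        (by norm_num)).comp (Filter.tendsto_add_atTop_nat 1)
      simpa [div_eq_mul_inv, Function.comp_def] using this.const_mul l
    · exact (by positivity : 0 < l / 2 ^ (k + 1))
  have hlim := hx (fun k i => dyadicCorner a l k (dyadicIndex a l k x) i + l / 2 ^ (k + 1)) _ hδ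
    (Filter.Eventually.of_forall fun k => by
      rw [one_mul, closedBall_eq_dyadicCube hl]
      exact dyadicCell_subset_dyadicCube hl _ _ rfl)
  rw [indicator_of_mem (hsub 0 rfl)] at hlim
  refine le_of_tendsto' hlim fun k => ?_
  have hk : ∫⁻ y in dyadicCell a l k (dyadicIndex a l k x), ‖f y‖ₑ ≤
      ENNReal.ofReal t * volume (dyadicCell a l k (dyadicIndex a l k x)) := by
    by_contra h
    exact hxt ⟨hx0, k, not_le.1 h⟩
  have hvol : volume (dyadicCell a l k (dyadicIndex a l k x)) ≠ ⊤ := by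
    rw [volume_dyadicCell hl]
    finiteness
  have hint : ∫ y in dyadicCell a l k (dyadicIndex a l k x), |f y| ≤
      t * volume.real (dyadicCell a l k (dyadicIndex a l k x)) := by
    rw [← integral_congr_ae (Filter.Eventually.of_forall fun y => Real.norm_eq_abs (f y)),
      integral_norm_eq_lintegral_enorm (hf.mono_set (hsub k)).aestronglyMeasurable]
    refine (ENNReal.toReal_mono (by finiteness) hk).trans_eq ?_
    rw [ENNReal.toReal_mul, ENNReal.toReal_ofReal ht, Measure.real]
  rw [closedBall_eq_dyadicCube hl, ← setAverage_congr (dyadicCell_ae_eq hl _ _), setAverage_eq,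
    setIntegral_congr_fun (measurableSet_dyadicCell hl _ _)
      fun y hy => indicator_of_mem (hsub k hy) _, smul_eq_mul]
  have hpos : 0 < volume.real (dyadicCell a l k (dyadicIndex a l k x)) := by
    rw [Measure.real, volume_dyadicCell hl]
    have : 0 < l / 2 ^ k := by positivity
    exact ENNReal.toReal_pos (pow_ne_zero n (ENNReal.ofReal_pos.2 this).ne') (by finiteness)
  rwa [inv_mul_le_iff₀ hpos, mul_comm]

theorem distFun_le_volume_maximalLevel (hl : 0 < l) (hf : IntegrableOn f (closedCube a l))
    {t : ℝ} (ht : 0 ≤ t) : distFun (volume.restrict (closedCube a l)) f t ≤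
      volume (maximalLevel a l (‖f ·‖ₑ) (ENNReal.ofReal t)) := by
  have hmeas : MeasurableSet (closedCube a l) := (isCube_closedCube a hl).isClosed.measurableSet
  rw [distFun, Measure.restrict_apply₀' hmeas.nullMeasurableSet]
  refine measure_mono_ae ?_
  have h0 := dyadicCell_ae_eq (a := a) hl 0 0
  rw [dyadicCube_zero_zero] at h0
  filter_upwards [ae_abs_le_of_notMem_maximalLevel hl hf ht, h0.mem_iff] with x hx hx0 hxS
  by_contra h
  exact absurd (hx (hx0.2 hxS.2) h) (not_le.2 hxS.1)

end CalderonZygmund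

theorem exists_rpow_mul_le_of_recursion {φ : ℝ → ℝ} {p K D V t₀ : ℝ} (hp : 1 < p) (hK : 1 < K)
    (hD : 0 ≤ D) (ht₀ : 0 < t₀) (hφ : ∀ t, 0 ≤ φ t) (hV : ∀ t, φ t ≤ V)
    (hrec : ∀ s, t₀ ≤ s → s * φ (K * s) ≤ D * φ s ^ (1 - 1 / p)) :
    ∃ B, ∀ t, t₀ ≤ t → t ^ p * φ t ≤ B := by
  have hp0 : 0 < p := by linarith
  have hK0 : 0 < K := by linarith
  have hr : 0 < 1 - 1 / p := by rw [sub_pos, div_lt_one hp0]; exact hp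
  set B := max ((K ^ p * D) ^ p) ((K * t₀) ^ p * V) with hB
  have hB0 : 0 ≤ B := le_max_of_le_left (by positivity)
  have hstep : K ^ p * D * B ^ (1 - 1 / p) ≤ B := by
    have h1 : K ^ p * D ≤ B ^ (1 / p) := by
      calc K ^ p * D = ((K ^ p * D) ^ p) ^ (1 / p) := by
            rw [← Real.rpow_mul (by positivity), mul_one_div_cancel hp0.ne', Real.rpow_one]
        _ ≤ B ^ (1 / p) := by gcongr; exact le_max_left _ _
    calc K ^ p * D * B ^ (1 - 1 / p) ≤ B ^ (1 / p) * B ^ (1 - 1 / p) := by gcongr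
      _ = B := by
        rw [← Real.rpow_add_of_nonneg hB0 (by positivity) hr.le, add_sub_cancel, Real.rpow_one]
  have key (m : ℕ) : ∀ t, t₀ ≤ t → t ≤ K ^ (m + 1) * t₀ → t ^ p * φ t ≤ B := by
    induction m with
    | zero =>
      intro t ht htK
      refine le_max_of_le_right ?_
      have : 0 < t := ht₀.trans_le ht
      have h1 := hφ t
      have h2 := hV t
      rw [zero_add, pow_one] at htK
      gcongr
    | succ m ih =>
      intro t ht htK
      rcases le_total t (K * t₀) with h | h
      · refine ih t ht (h.trans ?_)
        gcongr
        exact le_self_pow₀ hK.le (Nat.succ_ne_zero m)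
      · obtain ⟨s, rfl⟩ : ∃ s, t = K * s := ⟨t / K, by field_simp⟩
        have hs : t₀ ≤ s := le_of_mul_le_mul_left h hK0
        have hs0 : 0 < s := ht₀.trans_le hs
        have hsB := ih s hs (le_of_mul_le_mul_left (by rw [← mul_assoc, ← pow_succ']; exact htK) hK0)
        have hφs := hφ s
        calc (K * s) ^ p * φ (K * s) = K ^ p * s ^ (p - 1) * (s * φ (K * s)) := by
              rw [Real.mul_rpow hK0.le hs0.le, Real.rpow_sub_one hs0.ne']
              field_simp
          _ ≤ K ^ p * s ^ (p - 1) * (D * φ s ^ (1 - 1 / p)) := by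
              exact mul_le_mul_of_nonneg_left (hrec s hs) (by positivity)
          _ = K ^ p * D * (s ^ p * φ s) ^ (1 - 1 / p) := by
              rw [Real.mul_rpow (by positivity) hφs, ← Real.rpow_mul hs0.le, mul_sub,
                mul_one_div_cancel hp0.ne', mul_one]
              ring
          _ ≤ K ^ p * D * B ^ (1 - 1 / p) := by gcongr
          _ ≤ B := hstep
  refine ⟨B, fun t ht => ?_⟩
  obtain ⟨m, hm⟩ := pow_unbounded_of_one_lt (t / t₀) hK
  refine key m t ht ?_
  rw [div_lt_iff₀ ht₀] at hm
  refine hm.le.trans ?_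
  gcongr
  · exact hK.le
  · omega

theorem wkNorm_ne_top_of_forall_pairOsc_le {n : ℕ} (hn : 0 < n) {p : ℝ} (hp : 1 < p)
    {a : Fin n → ℝ} {l : ℝ} (hl : 0 < l) {f : (Fin n → ℝ) → ℝ}
    (hf : IntegrableOn f (closedCube a l)) {C : ℝ≥0∞} (hC : C ≠ ⊤)
    (hbound : ∀ Q : ℕ → Set (Fin n → ℝ), IsPackingIn (closedCube a l) Q →
      ∑' i, pairOsc f (Q i) ≤ C * (∑' i, volume (Q i)) ^ (1 - 1 / p)) :
    wkNorm (volume.restrict (closedCube a l)) p f ≠ ⊤ := by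
  have hp0 : 0 < p := by linarith
  have hr : 0 < 1 - 1 / p := by rw [sub_pos, div_lt_one hp0]; exact hp
  have hQ := isCube_closedCube a hl
  set V := volume (closedCube a l) with hVdef
  have hV0 : V ≠ 0 := hQ.volume_ne_zero
  have hVtop : V ≠ ⊤ := hQ.volume_ne_top
  have hcell : volume (dyadicCell a l 0 0) = V := by
    rw [measure_congr (dyadicCell_ae_eq hl 0 0), dyadicCube_zero_zero]
  have hint : ∫⁻ x in dyadicCell a l 0 0, ‖f x‖ₑ ≠ ⊤ := by
    rw [setLIntegral_congr (dyadicCell_ae_eq hl 0 0), dyadicCube_zero_zero]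
    exact hf.2.ne
  set A := (∫⁻ x in dyadicCell a l 0 0, ‖f x‖ₑ) / V with hA
  have hAtop : A ≠ ⊤ := ENNReal.div_ne_top hint hV0
  set t₀ := A.toReal + 1 with ht₀
  have ht₀pos : 0 < t₀ := by positivity
  have hmean {t : ℝ} (ht : t₀ ≤ t) : ∫⁻ x in dyadicCell a l 0 0, ‖f x‖ₑ ≤
      ENNReal.ofReal t * volume (dyadicCell a l 0 0) := by
    rw [hcell, ← ENNReal.div_le_iff hV0 hVtop]
    exact ENNReal.le_ofReal_iff_toReal_le hAtop (by linarith) |>.2 (by linarith)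
  set Ω : ℝ → Set (Fin n → ℝ) := fun t => maximalLevel a l (‖f ·‖ₑ) (ENNReal.ofReal t) with hΩ
  have hΩV (t : ℝ) : volume (Ω t) ≤ V := hcell ▸ measure_mono fun x hx => hx.1
  have hΩtop (t : ℝ) : volume (Ω t) ≠ ⊤ := ne_top_of_le_ne_top hVtop (hΩV t)
  set K : ℝ := 2 * 2 ^ n with hK
  have hK1 : 1 < K := by
    have : (1 : ℝ) ≤ 2 ^ n := one_le_pow₀ (by norm_num)
    linarith
  have hrec (s : ℝ) (hs : t₀ ≤ s) : s * (volume (Ω (K * s))).toReal ≤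
      (2 * C.toReal) * (volume (Ω s)).toReal ^ (1 - 1 / p) := by
    have hs0 : 0 < s := ht₀pos.trans_le hs
    have h1 : ENNReal.ofReal (K * s) * volume (Ω (K * s)) ≤
        2 * (C * volume (Ω s) ^ (1 - 1 / p)) +
          2 ^ n * ENNReal.ofReal s * volume (Ω (K * s)) :=
      (mul_volume_maximalLevel_le hl).trans <|
        (lintegral_maximalLevel_le hl hf
          (ENNReal.ofReal_le_ofReal (le_mul_of_one_le_left hs0.le hK1.le)) (hmean hs)).trans <|
        add_le_add_left (tsum_pairOsc_stoppingCubes_le hn hl hr.le hC hbound (hmean hs)) _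
    have hpow : volume (Ω s) ^ (1 - 1 / p) ≠ ⊤ := ENNReal.rpow_ne_top_of_nonneg hr.le (hΩtop s)
    have hfin1 : 2 * (C * volume (Ω s) ^ (1 - 1 / p)) ≠ ⊤ := by finiteness
    have hfin2 : 2 ^ n * ENNReal.ofReal s * volume (Ω (K * s)) ≠ ⊤ :=
      ENNReal.mul_ne_top (by finiteness) (hΩtop _)
    have h2 := ENNReal.toReal_mono (ENNReal.add_ne_top.2 ⟨hfin1, hfin2⟩) h1
    rw [ENNReal.toReal_add hfin1 hfin2] at h2
    simp only [ENNReal.toReal_mul, ENNReal.toReal_pow, ENNReal.toReal_ofNat,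
      ENNReal.toReal_ofReal hs0.le, ENNReal.toReal_ofReal (by positivity : 0 ≤ K * s),
      ← ENNReal.toReal_rpow] at h2
    have hone : (1 : ℝ) ≤ 2 ^ n := one_le_pow₀ (by norm_num)
    have hnn : 0 ≤ s * (volume (Ω (K * s))).toReal := by positivity
    have h3 : 2 ^ n * (s * (volume (Ω (K * s))).toReal) ≤
        (2 * C.toReal) * (volume (Ω s)).toReal ^ (1 - 1 / p) := by
      rw [hK] at h2 ⊢
      linarith
    exact (le_mul_of_one_le_left hnn hone).trans h3
  obtain ⟨B, hB⟩ := exists_rpow_mul_le_of_recursion (φ := fun t => (volume (Ω t)).toReal) hp hK1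
    (by positivity : 0 ≤ 2 * C.toReal) ht₀pos (fun t => ENNReal.toReal_nonneg)
    (fun t => ENNReal.toReal_mono hVtop (hΩV t)) hrec
  have hpinv : 0 ≤ 1 / p := by positivity
  refine ne_top_of_le_ne_top (b := max (ENNReal.ofReal (B ^ (1 / p)))
    (ENNReal.ofReal t₀ * V ^ (1 / p))) ?_ (iSup₂_le fun t ht => ?_)
  · exact max_ne_top ENNReal.ofReal_ne_top
      (ENNReal.mul_ne_top ENNReal.ofReal_ne_top (ENNReal.rpow_ne_top_of_nonneg hpinv hVtop))
  rcases le_total t₀ t with h | h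
  · refine le_max_of_le_left ?_
    have h1 : ENNReal.ofReal t * volume (Ω t) ^ (1 / p) =
        ENNReal.ofReal ((t ^ p * (volume (Ω t)).toReal) ^ (1 / p)) := by
      rw [Real.mul_rpow (by positivity) ENNReal.toReal_nonneg, ← Real.rpow_mul ht.le,
        mul_one_div_cancel hp0.ne', Real.rpow_one, ENNReal.ofReal_mul ht.le,
        ← ENNReal.ofReal_rpow_of_nonneg ENNReal.toReal_nonneg hpinv,
        ENNReal.ofReal_toReal (hΩtop t)]
    calc ENNReal.ofReal t * distFun (volume.restrict (closedCube a l)) f t ^ (1 / p)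
        ≤ ENNReal.ofReal t * volume (Ω t) ^ (1 / p) := by
          gcongr
          exact distFun_le_volume_maximalLevel hl hf ht.le
      _ ≤ ENNReal.ofReal (B ^ (1 / p)) := by
          rw [h1]
          gcongr
          exact hB t h
  · refine le_max_of_le_right ?_
    gcongr
    exact (measure_mono (subset_univ _)).trans_eq (by simp [hVdef])

theorem wkNorm_ne_top_of_unique {α : Type*} [Unique α] [MeasurableSpace α]
    (μ : Measure α) [IsFiniteMeasure μ] {p : ℝ} (hp : 0 < p) (f : α → ℝ) :
    wkNorm μ p f ≠ ⊤ := by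
  refine ne_top_of_le_ne_top (b := ENNReal.ofReal |f default| * μ univ ^ (1 / p)) ?_
    (iSup₂_le fun t ht => ?_)
  · exact ENNReal.mul_ne_top ENNReal.ofReal_ne_top
      (ENNReal.rpow_ne_top_of_nonneg (by positivity) (measure_ne_top μ _))
  by_cases htx : t < |f default|
  · gcongr
    exact measure_mono (subset_univ _)
  · have : {y | t < |f y|} = ∅ :=
      eq_empty_of_forall_notMem fun y hy => htx (Subsingleton.elim y default ▸ hy)
    simp [distFun, this, hp]

theorem pairOsc_le {n : ℕ} {f : (Fin n → ℝ) → ℝ} {Q : Set (Fin n → ℝ)} (hQ : IsCube Q) :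
    pairOsc f Q ≤ 2 * ∫⁻ x in Q, ‖f x‖ₑ := by
  have h0 := hQ.volume_ne_zero
  have h1 := hQ.volume_ne_top
  calc pairOsc f Q ≤ (volume Q)⁻¹ * ∫⁻ x in Q, ∫⁻ y in Q, (‖f x‖ₑ + ‖f y‖ₑ) := by
        rw [pairOsc]
        gcongr with x y
        rw [← Real.enorm_eq_ofReal_abs]
        exact enorm_sub_le
    _ = (volume Q)⁻¹ * (volume Q * (2 * ∫⁻ x in Q, ‖f x‖ₑ)) := by
        congr 1
        calc ∫⁻ x in Q, ∫⁻ y in Q, (‖f x‖ₑ + ‖f y‖ₑ)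
            = ∫⁻ x in Q, (‖f x‖ₑ * volume Q + ∫⁻ y in Q, ‖f y‖ₑ) := by
              refine lintegral_congr fun x => ?_
              rw [lintegral_add_left measurable_const, setLIntegral_const]
          _ = (∫⁻ x in Q, ‖f x‖ₑ) * volume Q + (∫⁻ y in Q, ‖f y‖ₑ) * volume Q := by
              rw [lintegral_add_right _ measurable_const, setLIntegral_const,
                lintegral_mul_const' _ _ h1]
          _ = _ := by ring
    _ = 2 * ∫⁻ x in Q, ‖f x‖ₑ := by rw [← mul_assoc, ENNReal.inv_mul_cancel h0 h1, one_mul]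

theorem distFun_le_of_wkNorm {α : Type*} [MeasurableSpace α] {μ : Measure α} {p : ℝ} (hp : 0 < p)
    {f : α → ℝ} (h : wkNorm μ p f ≠ ⊤) {t : ℝ} (ht : 0 < t) :
    distFun μ f t ≤ ENNReal.ofReal ((wkNorm μ p f).toReal ^ p * t ^ (-p)) := by
  have h1 : ENNReal.ofReal t * distFun μ f t ^ (1 / p) ≤ wkNorm μ p f :=
    le_iSup₂ (f := fun (t : ℝ) (_ : 0 < t) => ENNReal.ofReal t * distFun μ f t ^ (1 / p)) t ht
  have ht0 : ENNReal.ofReal t ≠ 0 := (ENNReal.ofReal_pos.2 ht).ne'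
  have h2 : distFun μ f t ^ (1 / p) ≤ ENNReal.ofReal ((wkNorm μ p f).toReal / t) := by
    rw [ENNReal.ofReal_div_of_pos ht, ENNReal.ofReal_toReal h,
      ENNReal.le_div_iff_mul_le (Or.inl ht0) (Or.inl ENNReal.ofReal_ne_top), mul_comm]
    exact h1
  have h3 := ENNReal.rpow_le_rpow h2 hp.le
  rwa [← ENNReal.rpow_mul, one_div_mul_cancel hp.ne', ENNReal.rpow_one,
    ENNReal.ofReal_rpow_of_nonneg (by positivity) hp.le,
    Real.div_rpow ENNReal.toReal_nonneg ht.le, div_eq_mul_inv, ← Real.rpow_neg ht.le] at h3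

/-- Integrals of a weak `L^p` function over sets of finite measure. -/
theorem setLIntegral_le_of_wkNorm {α : Type*} [MeasurableSpace α] {μ : Measure α} {p : ℝ}
    (hp : 1 < p) {f : α → ℝ} (hf : AEMeasurable f μ) (h : wkNorm μ p f ≠ ⊤) {E : Set α}
    (hE : μ E ≠ ⊤) : ∫⁻ x in E, ‖f x‖ₑ ∂μ ≤
      ENNReal.ofReal (1 + (wkNorm μ p f).toReal ^ p / (p - 1)) * μ E ^ (1 - 1 / p) := by
  have hp0 : 0 < p := by linarith
  have hp1 : 0 < p - 1 := by linarith
  rcases eq_or_ne (μ E) 0 with h0 | h0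
  · rw [setLIntegral_measure_zero _ _ h0]
    exact zero_le
  set A := (wkNorm μ p f).toReal with hA
  have hA0 : 0 ≤ A := ENNReal.toReal_nonneg
  obtain ⟨e, he, heE⟩ : ∃ e : ℝ, 0 < e ∧ μ E = ENNReal.ofReal e :=
    ⟨(μ E).toReal, ENNReal.toReal_pos h0 hE, (ENNReal.ofReal_toReal hE).symm⟩
  set s := e ^ (-(1 / p)) with hs
  have hs0 : 0 < s := by positivity
  have htail : ∫⁻ t in Ioi s, ENNReal.ofReal (A ^ p * t ^ (-p)) =
      ENNReal.ofReal (A ^ p * (s ^ (1 - p) / (p - 1))) := by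
    rw [← ofReal_integral_eq_lintegral_ofReal
      ((integrableOn_Ioi_rpow_of_lt (by linarith) hs0).const_mul _)
      (ae_restrict_of_forall_mem measurableSet_Ioi fun t ht => by
        have : 0 < t := hs0.trans ht
        positivity),
      integral_const_mul, integral_Ioi_rpow_of_lt (by linarith) hs0]
    congr 2
    rw [show -p + 1 = -(p - 1) by ring, div_neg, neg_div, neg_neg, neg_sub]
  simp_rw [Real.enorm_eq_ofReal_abs]
  calc ∫⁻ x in E, ENNReal.ofReal |f x| ∂μ
      = ∫⁻ t in Ioi 0, μ.restrict E {x | t < |f x|} :=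
        lintegral_eq_lintegral_meas_lt _ (Filter.Eventually.of_forall fun x => abs_nonneg _)
          hf.restrict.abs
    _ = (∫⁻ t in Ioc 0 s, μ.restrict E {x | t < |f x|}) +
          ∫⁻ t in Ioi s, μ.restrict E {x | t < |f x|} := by
        rw [← lintegral_union measurableSet_Ioi (Ioc_disjoint_Ioi le_rfl),
          Ioc_union_Ioi_eq_Ioi hs0.le]
    _ ≤ (∫⁻ _ in Ioc 0 s, μ E) + ∫⁻ t in Ioi s, ENNReal.ofReal (A ^ p * t ^ (-p)) := by
        refine add_le_add (lintegral_mono fun t => ?_)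
          (setLIntegral_mono' measurableSet_Ioi fun t ht => ?_)
        · exact (measure_mono (subset_univ _)).trans_eq (by simp)
        · exact (Measure.restrict_apply_le _ _).trans (distFun_le_of_wkNorm hp0 h (hs0.trans ht))
    _ = ENNReal.ofReal (e * s + A ^ p * (s ^ (1 - p) / (p - 1))) := by
        rw [htail, setLIntegral_const, Real.volume_Ioc, sub_zero, heE,
          ← ENNReal.ofReal_mul he.le, ← ENNReal.ofReal_add (by positivity) (by positivity)]
    _ = _ := by
        have h1 : e * s = e ^ (1 - 1 / p) := by
          rw [hs, sub_eq_add_neg, Real.rpow_add he, Real.rpow_one]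
        have h2 : s ^ (1 - p) = e ^ (1 - 1 / p) := by
          rw [hs, ← Real.rpow_mul he.le]
          congr 1
          field_simp
          ring
        rw [heE, ENNReal.ofReal_rpow_of_pos he, ← ENNReal.ofReal_mul (by positivity), h1, h2]
        congr 1
        ring

theorem tsum_pairOsc_le_of_wkNorm {n : ℕ} {p : ℝ} (hp : 1 < p) {Q₀ : Set (Fin n → ℝ)}
    (hQ₀ : IsCube Q₀) {f : (Fin n → ℝ) → ℝ} (hf : IntegrableOn f Q₀)
    (h : wkNorm (volume.restrict Q₀) p f ≠ ⊤) {Q : ℕ → Set (Fin n → ℝ)} (hQ : IsPackingIn Q₀ Q) :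
    ∑' i, pairOsc f (Q i) ≤
      2 * ENNReal.ofReal (1 + (wkNorm (volume.restrict Q₀) p f).toReal ^ p / (p - 1)) *
        (∑' i, volume (Q i)) ^ (1 - 1 / p) := by
  have hsub : ⋃ i, Q i ⊆ Q₀ := iUnion_subset fun i => (hQ.1 i).2
  have hE : volume.restrict Q₀ (⋃ i, Q i) = ∑' i, volume (Q i) := by
    rw [Measure.restrict_eq_self _ hsub, volume_iUnion_cubes (fun i => (hQ.1 i).1) hQ.2]
  calc ∑' i, pairOsc f (Q i) ≤ ∑' i, 2 * ∫⁻ x in Q i, ‖f x‖ₑ :=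
        ENNReal.tsum_le_tsum fun i => pairOsc_le (hQ.1 i).1
    _ = 2 * ∫⁻ x in ⋃ i, Q i, ‖f x‖ₑ ∂(volume.restrict Q₀) := by
        rw [ENNReal.tsum_mul_left, ← lintegral_iUnion_cubes (fun i => (hQ.1 i).1) hQ.2,
          Measure.restrict_restrict_of_subset hsub]
    _ ≤ _ := by
        rw [mul_assoc, ← hE]
        gcongr
        refine setLIntegral_le_of_wkNorm hp hf.aemeasurable h (ne_top_of_le_ne_top
          hQ₀.volume_ne_top ?_)
        rw [Measure.restrict_eq_self _ hsub]
        exact measure_mono hsub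

/-- as sets of functions in `L¹(Q₀)`, `GaRo_p(Q₀) = L(p,∞)(Q₀)`:
`GaRo_p(f,Q₀) < ∞` iff `sup_{t>0} t (λ_f(t))^{1/p} < ∞`. -/
theorem gaRo_eq_weakLp {n : ℕ} (p : ℝ) (hp : 1 < p)
    (Q₀ : Set (Fin n → ℝ)) (hQ₀ : IsCube Q₀)
    (f : (Fin n → ℝ) → ℝ) (hf : IntegrableOn f Q₀) :
    GaRo p f Q₀ ≠ ⊤ ↔ wkNorm (volume.restrict Q₀) p f ≠ ⊤ := by
  constructor
  · intro h
    obtain ⟨C, hbound, hC⟩ : ∃ C : ℝ≥0∞, (∀ Q : ℕ → Set (Fin n → ℝ), IsPackingIn Q₀ Q →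
        ∑' i, pairOsc f (Q i) ≤ C * (∑' i, volume (Q i)) ^ (1 - 1 / p)) ∧ C ≠ ⊤ := by
      simpa [GaRo, sInf_eq_top, pairOsc] using h
    rcases Nat.eq_zero_or_pos n with rfl | hn
    · have : IsFiniteMeasure (volume.restrict Q₀) :=
        isFiniteMeasure_restrict.2 hQ₀.volume_ne_top
      exact wkNorm_ne_top_of_unique _ (by linarith) f
    · obtain ⟨a, l, hl, rfl⟩ := hQ₀
      exact wkNorm_ne_top_of_forall_pairOsc_le hn hp hl hf hC hbound
  · intro h
    refine ne_top_of_le_ne_top ?_ (sInf_le fun Q hQ => tsum_pairOsc_le_of_wkNorm hp hQ₀ hf h hQ)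
    finiteness
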